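/- The affine intertwining operator 𝒥 : 𝒞(P) → 𝒞(P), defined by (𝒥f)(λ) = t[λ]⁻¹(T_{w_λ}f)(λ₊), is an invertible linear operator (a linear automorphism of 𝒞(P)). -/

import Mathlib

noncomputable section

open scoped RealInnerProductSpace BigOperators Classical
open Filter

namespace AffinePieri

variable {V : Type*} [NormedAddCommGroup V] [InnerProductSpace ℝ V] [FiniteDimensional ℝ V]

/-- The coroot `α^∨ = 2α/⟨α,α⟩` of a vector `α`. -/
def coroot (α : V) : V := (2 / ⟪α, α⟫) • α

lemma refl_involutive (α : V) (k : ℝ) :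
    Function.Involutive (fun x : V => x - (⟪x, coroot α⟫ + k) • α) := by
  intro x
  by_cases h : α = 0
  · simp [h, coroot]
  · have hαα : ⟪α, α⟫ ≠ 0 := fun hc => h (inner_self_eq_zero.mp hc)
    have h2 : ⟪α, coroot α⟫ = 2 := by
      rw [coroot, real_inner_smul_right]
      field_simp
    show (x - (⟪x, coroot α⟫ + k) • α) -
        (⟪x - (⟪x, coroot α⟫ + k) • α, coroot α⟫ + k) • α = x
    rw [inner_sub_left, real_inner_smul_left, h2]
    have key : (⟪x, coroot α⟫ + k) +
        (⟪x, coroot α⟫ - (⟪x, coroot α⟫ + k) * 2 + k) = 0 := by ring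
    rw [sub_sub, ← add_smul, key, zero_smul, sub_zero]

/-- The (affine) orthogonal reflection `x ↦ x - (⟨x,α^∨⟩ + k)α` as a permutation of `V`. -/
def reflP (α : V) (k : ℝ) : Equiv.Perm V :=
  Function.Involutive.toPerm _ (refl_involutive α k)

@[simp] lemma reflP_apply (α : V) (k : ℝ) (x : V) :
    reflP α k x = x - (⟪x, coroot α⟫ + k) • α := rfl

/-- The sign of a real number, as an integer. -/
def zsgn (v : ℝ) : ℤ := if 0 < v then 1 else if v < 0 then -1 else 0

/-- Alternating composition `f ∘ g ∘ f ∘ ⋯` with `m` factors, used for braid relations. -/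
def altOp {A : Type*} (f g : A → A) : ℕ → A → A
  | 0 => id
  | (k + 1) => f ∘ altOp g f k

/-- The interaction potential `v_α` entering the Morse (fusion) potential, for a
parameter family `s`. -/
def vintOf (s : V → ℝ) (α : V) (x : ℝ) : ℝ :=
  (1 - s α ^ 2) * ∫ y in (0:ℝ)..x, 1 / (1 - 2 * s α * Real.cos y + s α ^ 2)

/-- All the standing data of the paper: an irreducible reduced crystallographic root
system `R₀` spanning the Euclidean space `V`, with a positive system, simple roots,
highest (short) roots, an admissible pair `(R₀, R̂₀)` encoded by the map `hat` and the
affine root `α₀`, a `W₀`-invariant multiplicity function `t` with values in `(-1,1)`,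
and an integral level `c > 1`. -/
structure Setup (V : Type*) [NormedAddCommGroup V] [InnerProductSpace ℝ V]
    [FiniteDimensional ℝ V] where
  n : ℕ
  npos : 0 < n
  hdim : Module.finrank ℝ V = n
  R0 : Finset V
  zero_not_mem : (0 : V) ∉ R0
  span_top : Submodule.span ℝ (R0 : Set V) = ⊤
  cryst : ∀ α ∈ R0, ∀ β ∈ R0, ∃ k : ℤ, ⟪β, coroot α⟫ = (k : ℝ)
  refl_mem : ∀ α ∈ R0, ∀ β ∈ R0, β - ⟪β, coroot α⟫ • α ∈ R0
  reduced : ∀ α ∈ R0, ∀ r : ℝ, r • α ∈ R0 → r = 1 ∨ r = -1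
  irred : ¬ ∃ A B : Set V, A.Nonempty ∧ B.Nonempty ∧ A ∪ B = (R0 : Set V) ∧
      ∀ α ∈ A, ∀ β ∈ B, ⟪α, β⟫ = 0
  Rpos : Finset V
  pos_subset : Rpos ⊆ R0
  pos_partition : ∀ α ∈ R0, (α ∈ Rpos ↔ -α ∉ Rpos)
  simple : Fin n → V
  simple_mem : ∀ j, simple j ∈ Rpos
  pos_decomp : ∀ α ∈ Rpos, ∃ f : Fin n → ℕ, α = ∑ j, (f j : ℝ) • simple j
  hroot : V
  hroot_mem : hroot ∈ Rpos
  hroot_highest : ∀ β ∈ R0, ∃ f : Fin n → ℕ, hroot - β = ∑ j, (f j : ℝ) • simple j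
  hs : V
  hs_mem : hs ∈ Rpos
  hs_short : ∀ α ∈ R0, ⟪hs, hs⟫ ≤ ⟪α, α⟫
  hs_highest : ∀ β ∈ R0, ⟪β, β⟫ = ⟪hs, hs⟫ →
      ∃ f : Fin n → ℕ, hs - β = ∑ j, (f j : ℝ) • simple j
  hat : V → V
  a0 : V
  admissible : ((∀ α : V, hat α = coroot α) ∧ a0 = -hs) ∨
      ((∀ α : V, hat α = (2 / ⟪hroot, hroot⟫) • α) ∧ a0 = -hroot)
  t : V → ℝ
  t_bound : ∀ α ∈ R0, |t α| < 1
  t_invariant : ∀ α ∈ R0, ∀ β ∈ R0, t (β - ⟪β, coroot α⟫ • α) = t β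
  c : ℤ
  c_gt : 1 < c

namespace Setup

variable (S : Setup V)

/-- `m_α = 2/⟨α, α̂⟩`. -/
def m (α : V) : ℝ := 2 / ⟪α, S.hat α⟫

/-- The finite Weyl group `W₀`, generated by the reflections in the roots. -/
def W0 : Subgroup (Equiv.Perm V) :=
  Subgroup.closure {w | ∃ α ∈ S.R0, w = reflP α 0}

/-- The affine Weyl group `W`, generated by the affine reflections
`s_a` for `a = α^∨ + m_α r c`. -/
def W : Subgroup (Equiv.Perm V) :=
  Subgroup.closure {w | ∃ α ∈ S.R0, ∃ r : ℤ, w = reflP α (S.m α * (r : ℝ) * (S.c : ℝ))}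

/-- The `W₀`-orbit of a vector. -/
def orb (ω : V) : Set V := {x | ∃ w ∈ S.W0, w ω = x}

/-- The weight lattice `P` of `R₀`. -/
def Plat : Set V := {x | ∀ α ∈ S.R0, ∃ k : ℤ, ⟪x, coroot α⟫ = (k : ℝ)}

/-- The root lattice `Q` of `R₀`. -/
def Qlat : Set V := (AddSubgroup.closure (S.R0 : Set V) : Set V)

/-- The semigroup `Q⁺` generated by the positive roots. -/
def Qplus : Set V := (AddSubmonoid.closure (S.Rpos : Set V) : Set V)

/-- The cone `P⁺` of dominant weights. -/
def Pplus : Set V := {x | x ∈ S.Plat ∧ ∀ α ∈ S.Rpos, 0 ≤ ⟪x, coroot α⟫}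

/-- The dominant affine alcove `A_c = {x | 0 ≤ ⟨x,β⟩ ≤ c ∀ β ∈ R̂₀⁺}`. -/
def Alc : Set V := {x | ∀ α ∈ S.Rpos, 0 ≤ ⟪x, S.hat α⟫ ∧ ⟪x, S.hat α⟫ ≤ (S.c : ℝ)}

/-- `P_c = P ∩ A_c`. -/
def Pc : Set V := {x | x ∈ S.Plat ∧ x ∈ S.Alc}

/-- The weight lattice `P̂` of `R̂₀`. -/
def Phat : Set V := {x | ∀ α ∈ S.R0, ∃ k : ℤ, ⟪x, coroot (S.hat α)⟫ = (k : ℝ)}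

/-- `P̂_c = {μ ∈ P̂ | 0 ≤ ⟨μ,α⟩ ≤ c ∀ α ∈ R₀⁺}`. -/
def Phatc : Set V :=
  {x | x ∈ S.Phat ∧ ∀ α ∈ S.Rpos, 0 ≤ ⟪x, α⟫ ∧ ⟪x, α⟫ ≤ (S.c : ℝ)}

/-- The half sum `ρ` of the positive roots of `R₀`. -/
def rho : V := (2⁻¹ : ℝ) • ∑ α ∈ S.Rpos, α

/-- The half sum `ρ̂` of the positive roots of `R̂₀`. -/
def rhoHat : V := (2⁻¹ : ℝ) • ∑ α ∈ S.Rpos, S.hat α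

/-- The coroot lattice `Q̂^∨` of `R̂₀`. -/
def Qhatvee : Set V :=
  (AddSubgroup.closure ((fun α => coroot (S.hat α)) '' (S.R0 : Set V)) : Set V)

/-- The gradient (direction) of the affine simple root `a_j`:
`α₀` for `j = 0` and `α_j` otherwise. -/
def alpha (j : Fin (S.n + 1)) : V :=
  if h : (j : ℕ) = 0 then S.a0 else S.simple ⟨(j : ℕ) - 1, by have := j.isLt; omega⟩

/-- The constant term of the affine simple root `a_j`. -/
def kconst (j : Fin (S.n + 1)) : ℝ := if (j : ℕ) = 0 then (S.c : ℝ) else 0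

/-- The affine simple root `a_j` as an affine function on `V`. -/
def aFun (j : Fin (S.n + 1)) (x : V) : ℝ := ⟪x, coroot (S.alpha j)⟫ + S.kconst j

/-- The simple affine reflections `s_0, s_1, …, s_n`. -/
def sgen (j : Fin (S.n + 1)) : Equiv.Perm V := reflP (S.alpha j) (S.kconst j)

/-- The length of an element of the affine Weyl group: the minimal length of an
expression as a product of the simple reflections. -/
def len (w : Equiv.Perm V) : ℕ :=
  sInf {k | ∃ l : List (Fin (S.n + 1)), l.length = k ∧ (l.map S.sgen).prod = w}

/-- The length of an element of the finite Weyl group w.r.t. the simple reflections. -/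
def len0 (w : Equiv.Perm V) : ℕ :=
  sInf {k | ∃ l : List (Fin S.n), l.length = k ∧
    (l.map fun j => reflP (S.simple j) 0).prod = w}

/-- `l` is a reduced expression for `w`. -/
def IsReducedWord (l : List (Fin (S.n + 1))) (w : Equiv.Perm V) : Prop :=
  (l.map S.sgen).prod = w ∧ l.length = S.len w

/-- The Bruhat partial order on the affine Weyl group. -/
def BruhatLE (v w : Equiv.Perm V) : Prop :=
  ∃ l : List (Fin (S.n + 1)), S.IsReducedWord l w ∧
    ∃ l' : List (Fin (S.n + 1)), l'.Sublist l ∧ (l'.map S.sgen).prod = v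

/-- Evaluation of a function on the weight lattice at a point of `V` (by `0` off `P`). -/
def ev (f : ↥S.Plat → ℂ) (x : V) : ℂ := if h : x ∈ S.Plat then f ⟨x, h⟩ else 0

/-- The integral part `J_j` of the integral-reflection operators. -/
def Jop (j : Fin (S.n + 1)) (f : ↥S.Plat → ℂ) (x : ↥S.Plat) : ℂ :=
  if 0 < Int.floor (S.aFun j x.1) then
    -∑ k ∈ Finset.Icc (1 : ℤ) (Int.floor (S.aFun j x.1)),
      S.ev f (x.1 - (k : ℝ) • S.alpha j)
  else if Int.floor (S.aFun j x.1) < 0 then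
    ∑ k ∈ Finset.Icc (0 : ℤ) (-(Int.floor (S.aFun j x.1)) - 1),
      S.ev f (x.1 + (k : ℝ) • S.alpha j)
  else 0

/-- The integral-reflection operators `T_j = t_j s_j + (t_j - 1) J_j` on `𝒞(P)`. -/
def Top (j : Fin (S.n + 1)) (f : ↥S.Plat → ℂ) (x : ↥S.Plat) : ℂ :=
  (S.t (S.alpha j) : ℂ) * S.ev f ((S.sgen j)⁻¹ x.1) +
    ((S.t (S.alpha j) : ℂ) - 1) * S.Jop j f x

/-- The operator `T_{j₁} ∘ ⋯ ∘ T_{j_ℓ}` attached to a word `l = [j₁, …, j_ℓ]`. -/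
def wordOp (l : List (Fin (S.n + 1))) : (↥S.Plat → ℂ) → (↥S.Plat → ℂ) :=
  l.foldr (fun j g => S.Top j ∘ g) id

/-- `TW` realizes `w ↦ T_w` (via reduced expressions). -/
def IsTW (TW : Equiv.Perm V → (↥S.Plat → ℂ) → (↥S.Plat → ℂ)) : Prop :=
  ∀ w l, S.IsReducedWord l w → TW w = S.wordOp l

/-- `tw` realizes the length multiplicative function `w ↦ t_w` (via reduced expressions). -/
def IsTmult (tw : Equiv.Perm V → ℂ) : Prop :=
  ∀ w l, S.IsReducedWord l w → tw w = (l.map fun j => (S.t (S.alpha j) : ℂ)).prod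

/-- `wmin` realizes `x ↦ w_x`, the unique shortest affine Weyl group element moving `x`
into the dominant alcove. -/
def IsShortest (wmin : V → Equiv.Perm V) : Prop :=
  ∀ x : V, wmin x ∈ S.W ∧ wmin x x ∈ S.Alc ∧
    ∀ w ∈ S.W, w x ∈ S.Alc →
      S.len (wmin x) ≤ S.len w ∧ (S.len w = S.len (wmin x) → w = wmin x)

/-- The positive affine roots, encoded as pairs `(α, r)` representing `α^∨ + m_α r c`. -/
def RplusP : Set (V × ℤ) :=
  {p | p.1 ∈ S.R0 ∧ (1 ≤ p.2 ∨ (p.2 = 0 ∧ p.1 ∈ S.Rpos))}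

/-- The value of the affine root encoded by `p = (α, r)` at a point of `V`. -/
def affval (p : V × ℤ) (x : V) : ℝ :=
  ⟪x, coroot p.1⟫ + S.m p.1 * (p.2 : ℝ) * (S.c : ℝ)

/-- `R[λ] = {a ∈ R⁺ | a(λ) < 0}`. -/
def Raff (lam : V) : Set (V × ℤ) := {p | p ∈ S.RplusP ∧ S.affval p lam < 0}

/-- `t[λ] = ∏_{a ∈ R[λ]} t_{a'}`. -/
def tBr (lam : V) : ℂ := ∏ᶠ p ∈ S.Raff lam, (S.t p.1 : ℂ)

/-- `θ(λ) = |{a ∈ R⁺ | a(λ) = -2}|`. -/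
def thetaCt (lam : V) : ℕ :=
  Set.ncard {p : V × ℤ | p ∈ S.RplusP ∧ S.affval p lam = -2}

/-- The affine intertwining operator `𝒥`, defined via `wmin` and `TW`. -/
def JJ (wmin : V → Equiv.Perm V) (TW : Equiv.Perm V → (↥S.Plat → ℂ) → (↥S.Plat → ℂ))
    (f : ↥S.Plat → ℂ) (x : ↥S.Plat) : ℂ :=
  (S.tBr x.1)⁻¹ * S.ev (TW (wmin x.1) f) (wmin x.1 x.1)

/-- The Morse (fusion-potential) function `𝒱_μ` for a parameter family `s`. -/
def MorseOf (s : V → ℝ) (μ ξ : V) : ℝ :=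
  ((S.c : ℝ) / 2) * ⟪ξ, ξ⟫ - 2 * Real.pi * ⟪S.rhoHat + μ, ξ⟫ +
    ∑ α ∈ S.Rpos, (2 / ⟪α, coroot (S.hat α)⟫) * ∫ x in (0:ℝ)..(⟪ξ, α⟫), vintOf s α x

/-- The Morse function `𝒱_μ` for the multiplicity function of the setup. -/
def Morse (μ ξ : V) : ℝ := S.MorseOf S.t μ ξ

/-- The critical equation `cξ + ∑_{α∈R₀⁺} v_α(⟨ξ,α⟩) α̂ = 2π(ρ̂ + μ)`. -/
def CritEq (μ x : V) : Prop :=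
  (S.c : ℝ) • x + ∑ α ∈ S.Rpos, (vintOf S.t α ⟪x, α⟫) • S.hat α =
    (2 * Real.pi) • (S.rhoHat + μ)

/-- Extension of a parameter vector indexed by `R₀` to a function on `V` (by zero). -/
def extParam (s : ↥S.R0 → ℝ) : V → ℝ := fun α => if h : α ∈ S.R0 then s ⟨α, h⟩ else 0

/-- `xi` realizes `μ ↦ ξ_μ`, the unique global minimizer of `𝒱_μ`. -/
def IsMinimizer (xi : V → V) : Prop :=
  ∀ μ ∈ S.Phat, ∀ x : V, x ≠ xi μ → S.Morse μ (xi μ) < S.Morse μ x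

/-- The `c`-function of the Macdonald spherical function. -/
def Cfun (ξ : V) : ℂ :=
  ∏ α ∈ S.Rpos, (1 - (S.t α : ℂ) * Complex.exp (-(Complex.I * (⟪ξ, α⟫ : ℂ)))) /
      (1 - Complex.exp (-(Complex.I * (⟪ξ, α⟫ : ℂ))))

/-- The Macdonald spherical function `M_λ(ξ)`. -/
def Msph (lam ξ : V) : ℂ :=
  ∑ᶠ w ∈ (S.W0 : Set (Equiv.Perm V)),
    S.Cfun (w ξ) * Complex.exp (Complex.I * (⟪w ξ, lam⟫ : ℂ))

/-- The orbit sum `m_ω(e^{iξ})`. -/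
def mSym (ω ξ : V) : ℂ := ∑ᶠ ν ∈ S.orb ω, Complex.exp (Complex.I * (⟪ν, ξ⟫ : ℂ))

/-- The plane wave `e^{iξ} ∈ 𝒞(P)`. -/
def planewave (ξ : V) : ↥S.Plat → ℂ :=
  fun lam => Complex.exp (Complex.I * (⟪lam.1, ξ⟫ : ℂ))

/-- The free operator `L_{ω;1}`. -/
def Lfree (ω : V) (f : ↥S.Plat → ℂ) (x : ↥S.Plat) : ℂ :=
  ∑ᶠ ν ∈ S.orb ω, S.ev f (x.1 + ν)

/-- `φ_ξ = ∑_{v ∈ W₀} T_v e^{iξ}`. -/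
def phiW (TW : Equiv.Perm V → (↥S.Plat → ℂ) → (↥S.Plat → ℂ)) (ξ : V) : ↥S.Plat → ℂ :=
  ∑ᶠ w ∈ (S.W0 : Set (Equiv.Perm V)), TW w (S.planewave ξ)

/-- The affine Macdonald spherical function `Φ_ξ = 𝒥 φ_ξ`. -/
def PhiA (wmin : V → Equiv.Perm V)
    (TW : Equiv.Perm V → (↥S.Plat → ℂ) → (↥S.Plat → ℂ)) (ξ : V) : ↥S.Plat → ℂ :=
  S.JJ wmin TW (S.phiW TW ξ)

/-- Invariance of a lattice function under the affine Weyl group. -/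
def Winv (f : ↥S.Plat → ℂ) : Prop :=
  ∀ w ∈ S.W, ∀ x : ↥S.Plat, S.ev f (w⁻¹ x.1) = f x

/-- A minuscule dominant weight. -/
def Minuscule (ω : V) : Prop := ω ∈ S.Pplus ∧ ∀ α ∈ S.Rpos, ⟪ω, coroot α⟫ ≤ 1

/-- `P_ϑ^⋆`: the orbit of the minuscule and quasi-minuscule weights. -/
def Pstar : Set V :=
  {x | ∃ w ∈ S.W0, ∃ η : V, (S.Minuscule η ∨ η = S.hs) ∧ x = w η}

/-- `ê_t(η) = ∏_{β∈R̂₀⁺} t_β^{⟨η,β^∨⟩/2}`. -/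
def et (η : V) : ℂ :=
  ∏ α ∈ S.Rpos, (S.t α : ℂ) ^ (((⟪η, coroot (S.hat α)⟫ / 2 : ℝ) : ℂ))

/-- `ĥ_t = t_{α₀} ê_t(-α₀^∨)`. -/
def hhat : ℂ := (S.t S.a0 : ℂ) * S.et (-(coroot S.a0))

/-- `e_t(ν) = ∏_{α∈R₀⁺} t_α^{⟨ν,α^∨⟩/2}`. -/
def elit (ν : V) : ℂ :=
  ∏ α ∈ S.Rpos, (S.t α : ℂ) ^ (((⟪ν, coroot α⟫ / 2 : ℝ) : ℂ))

/-- `h_t = t_ϑ e_t(-α₀)`. -/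
def hlit : ℂ := (S.t S.hs : ℂ) * S.elit (-S.a0)

/-- The coefficients `d_{λ,ν}`. -/
def dcoef (lam ν : V) : ℂ :=
  if ν ∈ S.orb S.hs then
    (S.thetaCt (lam + ν) : ℂ) * S.elit (-ν) * S.hlit ^ zsgn ⟪lam, S.hat ν⟫
  else 0

/-- The Pieri coefficients `V_{λ,ν}(t)`. -/
def Vcoef (lam ν : V) : ℂ :=
  (∏ α ∈ S.Rpos, if ⟪lam, S.hat α⟫ = 0 ∧ 0 < ⟪ν, S.hat α⟫ then
      (1 - (S.t α : ℂ) * S.et (S.hat α)) / (1 - S.et (S.hat α)) else 1) *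
  ∏ α ∈ S.Rpos, if ⟪lam, S.hat α⟫ = (S.c : ℝ) ∧ ⟪ν, S.hat α⟫ < 0 then
      (1 - (S.t α : ℂ) * S.hhat * S.et (-(S.hat α))) / (1 - S.hhat * S.et (-(S.hat α)))
    else 1

/-- The Pieri coefficients `U_{λ,ω}(t)`. -/
def Ucoef (wmin : V → Equiv.Perm V) (lam ω : V) : ℂ :=
  (∑ᶠ ν ∈ {ν | ν ∈ S.orb ω ∧ wmin (lam + ν) (lam + ν) = lam}, S.tBr (lam + ν)) +
    (1 - (S.t S.hs : ℂ)⁻¹) *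
      ∑ᶠ ν ∈ {ν | ν ∈ S.orb ω ∧ wmin (lam + ν) lam = lam}, S.dcoef lam ν

/-- The linear part of an affine transformation of `V`. -/
def linp (w : Equiv.Perm V) (x : V) : V := w x - w (0 : V)

/-- The set `[x] = {y | y₊ = x₊, w_y ≤ w_x}`. -/
def bra (wmin : V → Equiv.Perm V) (x : V) : Set V :=
  {y | wmin y y = wmin x x ∧ S.BruhatLE (wmin y) (wmin x)}

/-- The partial order `μ ⪯ λ`. -/
def preceq (wmin : V → Equiv.Perm V) (μ lam : V) : Prop :=
  lam - μ ∈ S.Qlat ∧ convexHull ℝ (S.bra wmin μ) ⊆ convexHull ℝ (S.bra wmin lam)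

/-- The Weyl denominator `δ(ξ)`. -/
def weylDenom (ξ : V) : ℂ :=
  ∏ α ∈ S.Rpos, (Complex.exp (Complex.I * (⟪ξ, α⟫ : ℂ) / 2) -
      Complex.exp (-(Complex.I * (⟪ξ, α⟫ : ℂ) / 2)))

/-- The Weyl character `χ_λ(ξ)`. -/
def chiW (lam ξ : V) : ℂ :=
  (S.weylDenom ξ)⁻¹ * ∑ᶠ w ∈ (S.W0 : Set (Equiv.Perm V)),
    ((-1 : ℂ) ^ S.len0 w) * Complex.exp (Complex.I * (⟪w ξ, lam + S.rho⟫ : ℂ))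

/-- The counting function `N_{λ,ω}`. -/
def Ncount (lam ω : V) : ℕ :=
  Nat.card {j : Fin (S.n + 1) // S.aFun j lam = 0 ∧ S.alpha j ∈ S.orb ω}

end Setup


namespace Setup

variable (S : Setup V)

lemma inner_self_pos {α : V} (hα : α ∈ S.R0) : 0 < ⟪α, α⟫ := by
  apply real_inner_self_pos.mpr
  rintro rfl
  exact S.zero_not_mem hα

lemma inner_coroot_eq (x α : V) : ⟪x, coroot α⟫ = 2 / ⟪α, α⟫ * ⟪x, α⟫ := by
  rw [coroot, real_inner_smul_right]

lemma inner_coroot_self {α : V} (hα : α ∈ S.R0) : ⟪α, coroot α⟫ = 2 := by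
  have := S.inner_self_pos hα
  rw [inner_coroot_eq]; field_simp

lemma neg_mem_R0 {α : V} (hα : α ∈ S.R0) : -α ∈ S.R0 := by
  have h := S.refl_mem α hα α hα
  rw [S.inner_coroot_self hα] at h
  convert h using 1
  rw [two_smul]; abel

lemma refl_norm {β : V} (hβ : β ∈ S.R0) (α : V) :
    ⟪α - ⟪α, coroot β⟫ • β, α - ⟪α, coroot β⟫ • β⟫ = ⟪α, α⟫ := by
  have := S.inner_self_pos hβ
  simp only [inner_sub_left, inner_sub_right, real_inner_smul_left, real_inner_smul_right,
    inner_coroot_eq, real_inner_comm α β]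
  field_simp
  ring

lemma coroot_refl {α β : V} (hβ : β ∈ S.R0) (hα : α ∈ S.R0) (x : V) :
    ⟪x, coroot (α - ⟪α, coroot β⟫ • β)⟫ =
      ⟪x, coroot α⟫ - ⟪β, coroot α⟫ * ⟪x, coroot β⟫ := by
  rw [inner_coroot_eq, S.refl_norm hβ]
  have := S.inner_self_pos hβ
  have := S.inner_self_pos hα
  simp only [inner_sub_right, real_inner_smul_right, inner_coroot_eq, real_inner_comm α β]
  field_simp

/-- `hat α` is a positive multiple of `α`, and basic facts on `m`. -/
lemma hat_pos {α : V} (hα : α ∈ S.R0) : ∃ u : ℝ, 0 < u ∧ S.hat α = u • α := by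
  rcases S.admissible with ⟨h, -⟩ | ⟨h, -⟩
  · exact ⟨2 / ⟪α, α⟫, div_pos two_pos (S.inner_self_pos hα), h α⟩
  · exact ⟨_, div_pos two_pos (S.inner_self_pos (S.pos_subset S.hroot_mem)), h α⟩

lemma m_pos {α : V} (hα : α ∈ S.R0) : 0 < S.m α := by
  obtain ⟨u, hu, h⟩ := S.hat_pos hα
  have := S.inner_self_pos hα
  rw [m, h, real_inner_smul_right]
  positivity

lemma coroot_eq_hat {α : V} (hα : α ∈ S.R0) (x : V) :
    ⟪x, coroot α⟫ = S.m α * ⟪x, S.hat α⟫ := by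
  obtain ⟨u, hu, h⟩ := S.hat_pos hα
  have := S.inner_self_pos hα
  rw [m, h, real_inner_smul_right, real_inner_smul_right, inner_coroot_eq]
  field_simp

lemma m_refl {α β : V} (hβ : β ∈ S.R0) (hα : α ∈ S.R0) :
    S.m (α - ⟪α, coroot β⟫ • β) = S.m α := by
  have h1 := S.inner_self_pos hα
  have h2 := S.refl_norm hβ α
  rcases S.admissible with ⟨h, -⟩ | ⟨h, -⟩
  · rw [m, m, h, h, S.inner_coroot_self hα, S.inner_coroot_self (S.refl_mem β hβ α hα)]
  · rw [m, m, h, h, real_inner_smul_right, real_inner_smul_right, h2]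

lemma m_neg {α : V} (hα : α ∈ S.R0) : S.m (-α) = S.m α := by
  have := S.m_refl hα hα
  rw [S.inner_coroot_self hα] at this
  rw [← this]; congr 1; rw [two_smul]; abel

lemma coroot_neg (α : V) : coroot (-α) = - coroot α := by
  simp [coroot]

lemma a0_mem : S.a0 ∈ S.R0 := by
  rcases S.admissible with ⟨-, h⟩ | ⟨-, h⟩ <;> rw [h]
  · exact S.neg_mem_R0 (S.pos_subset S.hs_mem)
  · exact S.neg_mem_R0 (S.pos_subset S.hroot_mem)

lemma m_a0 : S.m S.a0 = 1 := by
  have h1 := S.inner_self_pos (S.pos_subset S.hroot_mem)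
  rcases S.admissible with ⟨h, h0⟩ | ⟨h, h0⟩
  · rw [m, h, S.inner_coroot_self S.a0_mem]; norm_num
  · rw [m, h, h0, real_inner_smul_right, inner_neg_neg]; field_simp

lemma alpha_zero (j : Fin (S.n + 1)) (h : (j : ℕ) = 0) : S.alpha j = S.a0 := by
  simp [alpha, h]

lemma alpha_succ (j : Fin S.n) : S.alpha j.succ = S.simple j := by
  simp [alpha]

lemma kconst_succ (j : Fin S.n) : S.kconst j.succ = 0 := by
  simp [kconst]

lemma alpha_mem (j : Fin (S.n + 1)) : S.alpha j ∈ S.R0 := by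
  refine Fin.cases ?_ (fun i => ?_) j
  · rw [S.alpha_zero 0 rfl]; exact S.a0_mem
  · rw [alpha_succ]; exact S.pos_subset (S.simple_mem i)

lemma simple_span : Submodule.span ℝ (Set.range S.simple) = ⊤ := by
  rw [eq_top_iff, ← S.span_top, Submodule.span_le]
  have key : ∀ α ∈ S.Rpos, α ∈ Submodule.span ℝ (Set.range S.simple) := by
    intro α hα
    obtain ⟨f, rfl⟩ := S.pos_decomp α hα
    exact Submodule.sum_mem _ fun j _ =>
      Submodule.smul_mem _ _ (Submodule.subset_span ⟨j, rfl⟩)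
  intro α hα
  by_cases h : α ∈ S.Rpos
  · exact key α h
  · have : -α ∈ S.Rpos := by
      by_contra h'
      exact h ((S.pos_partition α hα).2 h')
    simpa using Submodule.neg_mem _ (key _ this)

lemma simple_li : LinearIndependent ℝ S.simple :=
  linearIndependent_of_top_le_span_of_card_eq_finrank S.simple_span.ge
    (by rw [S.hdim]; simp)

/-- dual vectors -/
lemma exists_dual (g : Fin S.n → ℝ) : ∃ v : V, ∀ j, ⟪v, S.simple j⟫ = g j := by
  have := FiniteDimensional.complete ℝ V
  let b := Module.Basis.mk S.simple_li S.simple_span.ge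
  let L : V →ₗ[ℝ] ℝ := b.constr ℝ g
  refine ⟨(InnerProductSpace.toDual ℝ V).symm (LinearMap.toContinuousLinearMap L), fun j => ?_⟩
  rw [InnerProductSpace.toDual_symm_apply]
  have : S.simple j = b j := by simp [b]
  rw [this]
  simp [L]

lemma neg_of_not_pos {α : V} (hα : α ∈ S.R0) (h : α ∉ S.Rpos) : -α ∈ S.Rpos := by
  by_contra h'
  exact h ((S.pos_partition α hα).2 h')

lemma exists_x0 : ∃ x0 : V, (∀ α ∈ S.Rpos, 0 < ⟪x0, α⟫) ∧
    ∀ α ∈ S.R0, |⟪x0, S.hat α⟫| < S.c := by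
  obtain ⟨v, hv⟩ := S.exists_dual (fun _ => 1)
  have hpos : ∀ α ∈ S.Rpos, 0 < ⟪v, α⟫ := by
    intro α hα
    obtain ⟨f, hf⟩ := S.pos_decomp α hα
    have h0 : 0 ≤ ⟪v, α⟫ := by
      rw [hf, inner_sum]
      refine Finset.sum_nonneg fun j _ => ?_
      rw [real_inner_smul_right, hv]; positivity
    refine lt_of_le_of_ne h0 fun h => ?_
    rw [hf, inner_sum] at h
    have h2 := (Finset.sum_eq_zero_iff_of_nonneg (fun j _ => by
      rw [real_inner_smul_right, hv]; positivity)).1 h.symm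
    apply S.zero_not_mem
    have : α = 0 := by
      rw [hf]
      refine Finset.sum_eq_zero fun j hj => ?_
      have := h2 j hj
      rw [real_inner_smul_right, hv, mul_one] at this
      rw [this, zero_smul]
    exact this ▸ S.pos_subset hα
  set B : ℝ := 1 + ∑ α ∈ S.R0, |⟪v, S.hat α⟫| with hB
  have hBpos : 0 < B := by positivity
  refine ⟨B⁻¹ • v, fun α hα => ?_, fun α hα => ?_⟩
  · rw [real_inner_smul_left]
    exact mul_pos (inv_pos.2 hBpos) (hpos α hα)
  · rw [real_inner_smul_left, abs_mul, abs_of_pos (inv_pos.2 hBpos)]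
    have h1 : |⟪v, S.hat α⟫| ≤ ∑ α ∈ S.R0, |⟪v, S.hat α⟫| :=
      Finset.single_le_sum (f := fun α => |⟪v, S.hat α⟫|) (fun _ _ => abs_nonneg _) hα
    have hc : (1 : ℝ) < S.c := by exact_mod_cast S.c_gt
    have : B⁻¹ * |⟪v, S.hat α⟫| < 1 := by
      rw [inv_mul_lt_iff₀ hBpos]; linarith
    linarith

/-- simple reflection keeps the other positive roots positive -/
lemma simple_refl_pos (j : Fin S.n) {α : V} (hα : α ∈ S.Rpos) (hne : α ≠ S.simple j) :
    α - ⟪α, coroot (S.simple j)⟫ • S.simple j ∈ S.Rpos := by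
  have hj := S.pos_subset (S.simple_mem j)
  have hα0 := S.pos_subset hα
  by_contra hcon
  have hneg := S.neg_of_not_pos (S.refl_mem _ hj _ hα0) hcon
  obtain ⟨f, hf⟩ := S.pos_decomp α hα
  obtain ⟨g, hg⟩ := S.pos_decomp _ hneg
  have key : ∀ i, i ≠ j → f i = 0 := by
    intro i hij
    obtain ⟨v, hv⟩ := S.exists_dual (Pi.single i 1)
    have hv2 : ∀ f : Fin S.n → ℕ, ⟪v, ∑ j, (f j : ℝ) • S.simple j⟫ = f i := by
      intro f
      rw [inner_sum]
      simp [real_inner_smul_right, hv, Pi.single_apply]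
    have h1 := hv2 f
    have h2 := hv2 g
    rw [← hf] at h1
    rw [← hg, inner_neg_right, inner_sub_right, real_inner_smul_right, hv, h1,
      Pi.single_eq_of_ne hij.symm] at h2
    have : (f i : ℝ) + g i = 0 := by linarith
    have h3 : f i + g i = 0 := by exact_mod_cast this
    omega
  have h4 : α = (f j : ℝ) • S.simple j := by
    rw [hf]
    exact Finset.sum_eq_single j (fun i _ hi => by rw [key i hi]; simp) (by simp)
  rcases S.reduced _ hj (f j) (h4 ▸ hα0) with h | h
  · rw [h, one_smul] at h4; exact hne h4
  · have : (0 : ℝ) ≤ f j := Nat.cast_nonneg _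
    linarith

/-- a root is dominant if it dominates its simple reflections -/
lemma dominant_of_le {β : V}
    (h : ∀ j, ∃ f : Fin S.n → ℕ,
      β - (β - ⟪β, coroot (S.simple j)⟫ • S.simple j) = ∑ j, (f j : ℝ) • S.simple j) :
    ∀ α ∈ S.Rpos, 0 ≤ ⟪β, α⟫ := by
  obtain ⟨v, hv⟩ := S.exists_dual (fun _ => 1)
  have hs : ∀ j, 0 ≤ ⟪β, S.simple j⟫ := by
    intro j
    obtain ⟨f, hf⟩ := h j
    have h1 : ⟪β, coroot (S.simple j)⟫ = ∑ j, (f j : ℝ) := by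
      have := congrArg (fun x => ⟪v, x⟫) hf
      simpa [inner_sum, real_inner_smul_right, hv] using this
    have h2 : 0 ≤ ⟪β, coroot (S.simple j)⟫ := by rw [h1]; positivity
    rw [inner_coroot_eq] at h2
    have h3 := S.inner_self_pos (S.pos_subset (S.simple_mem j))
    exact nonneg_of_mul_nonneg_right h2 (by positivity)
  intro α hα
  obtain ⟨f, hf⟩ := S.pos_decomp α hα
  rw [hf, inner_sum]
  refine Finset.sum_nonneg fun j _ => ?_
  rw [real_inner_smul_right]
  exact mul_nonneg (Nat.cast_nonneg _) (hs j)

lemma hroot_dom : ∀ α ∈ S.Rpos, 0 ≤ ⟪S.hroot, α⟫ :=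
  S.dominant_of_le fun j => S.hroot_highest _
    (S.refl_mem _ (S.pos_subset (S.simple_mem j)) _ (S.pos_subset S.hroot_mem))

lemma hs_dom : ∀ α ∈ S.Rpos, 0 ≤ ⟪S.hs, α⟫ :=
  S.dominant_of_le fun j => S.hs_highest _
    (S.refl_mem _ (S.pos_subset (S.simple_mem j)) _ (S.pos_subset S.hs_mem))
    (S.refl_norm (S.pos_subset (S.simple_mem j)) _)

lemma hroot_long {β : V} (hβ : β ∈ S.R0) : ⟪β, β⟫ ≤ ⟪S.hroot, S.hroot⟫ := by
  obtain ⟨x0, hx0, -⟩ := S.exists_x0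
  obtain ⟨γ, hγ, hmax⟩ := Finset.exists_max_image
    (S.R0.filter fun γ => ⟪γ, γ⟫ = ⟪β, β⟫) (fun γ => ⟪x0, γ⟫) ⟨β, by simp [hβ]⟩
  rw [Finset.mem_filter] at hγ
  obtain ⟨hγ, hγβ⟩ := hγ
  have hdom : ∀ j, 0 ≤ ⟪γ, S.simple j⟫ := by
    intro j
    have hj := S.pos_subset (S.simple_mem j)
    have h1 := hmax (γ - ⟪γ, coroot (S.simple j)⟫ • S.simple j) (by
      rw [Finset.mem_filter]
      exact ⟨S.refl_mem _ hj _ hγ, (S.refl_norm hj _).trans hγβ⟩)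
    rw [inner_sub_right, real_inner_smul_right] at h1
    have h2 := hx0 _ (S.simple_mem j)
    have h3 : 0 ≤ ⟪γ, coroot (S.simple j)⟫ := by
      have : 0 ≤ ⟪γ, coroot (S.simple j)⟫ * ⟪x0, S.simple j⟫ := by linarith
      exact nonneg_of_mul_nonneg_left this h2
    rw [inner_coroot_eq] at h3
    have h4 := S.inner_self_pos hj
    exact nonneg_of_mul_nonneg_right h3 (by positivity)
  obtain ⟨f, hf⟩ := S.hroot_highest γ hγ
  have hA : 0 ≤ ⟪γ, S.hroot - γ⟫ := by
    rw [hf, inner_sum]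
    refine Finset.sum_nonneg fun j _ => ?_
    rw [real_inner_smul_right]
    exact mul_nonneg (Nat.cast_nonneg _) (hdom j)
  have hB : 0 ≤ ⟪S.hroot, S.hroot - γ⟫ := by
    rw [hf, inner_sum]
    refine Finset.sum_nonneg fun j _ => ?_
    rw [real_inner_smul_right]
    exact mul_nonneg (Nat.cast_nonneg _) (S.hroot_dom _ (S.simple_mem j))
  rw [inner_sub_right] at hA hB
  rw [real_inner_comm] at hA
  linarith

/-- integer pairing with `-a0` -/
lemma exists_k {α : V} (hα : α ∈ S.R0) : ∃ k : ℤ, ⟪S.hat α, -S.a0⟫ = k := by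
  rcases S.admissible with ⟨h, h0⟩ | ⟨h, h0⟩
  · obtain ⟨k, hk⟩ := S.cryst α hα S.hs (S.pos_subset S.hs_mem)
    exact ⟨k, by rw [h, h0, neg_neg, real_inner_comm, hk]⟩
  · obtain ⟨k, hk⟩ := S.cryst _ (S.pos_subset S.hroot_mem) α hα
    refine ⟨k, ?_⟩
    rw [h, h0, neg_neg, ← hk, inner_coroot_eq, real_inner_smul_left]

lemma a0_dom {α : V} (hα : α ∈ S.Rpos) : 0 ≤ ⟪S.hat α, -S.a0⟫ := by
  obtain ⟨u, hu, h⟩ := S.hat_pos (S.pos_subset hα)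
  rw [h, real_inner_smul_left, real_inner_comm]
  refine mul_nonneg hu.le ?_
  rcases S.admissible with ⟨-, h0⟩ | ⟨-, h0⟩
  · rw [h0, neg_neg]; exact S.hs_dom α hα
  · rw [h0, neg_neg]; exact S.hroot_dom α hα

lemma eq_of_two_le {α : V} (hα : α ∈ S.R0) (h2 : 2 ≤ ⟪S.hat α, -S.a0⟫) : α = -S.a0 := by
  have h1 := S.inner_self_pos hα
  have h3 := S.inner_self_pos (S.pos_subset S.hroot_mem)
  suffices h : ⟪α - -S.a0, α - -S.a0⟫ ≤ 0 by
    have := real_inner_self_nonpos.1 h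
    exact sub_eq_zero.1 this
  rw [real_inner_sub_sub_self]
  rcases S.admissible with ⟨h, h0⟩ | ⟨h, h0⟩
  · rw [h0, neg_neg, h, real_inner_comm, inner_coroot_eq, div_mul_eq_mul_div,
      le_div_iff₀ h1] at h2
    rw [h0, neg_neg]
    have hcomm := real_inner_comm α S.hs
    have := S.hs_short α hα
    linarith
  · rw [h0, neg_neg, h, real_inner_smul_left, div_mul_eq_mul_div, le_div_iff₀ h3] at h2
    rw [h0, neg_neg]
    have := S.hroot_long hα
    linarith

lemma hat_neg (α : V) : S.hat (-α) = - S.hat α := by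
  rcases S.admissible with ⟨h, -⟩ | ⟨h, -⟩ <;> simp [h, coroot_neg]

/-- dominant roots pair positively with `-a0` -/
lemma exists_simple_pos {α : V} (hα : α ∈ S.R0) : ∃ j, 0 < ⟪α, S.alpha j⟫ := by
  have hself := S.inner_self_pos hα
  by_contra! hcon
  have hcs : ∀ j, ⟪α, S.simple j⟫ ≤ 0 := fun j => by
    have := hcon j.succ; rwa [alpha_succ] at this
  have hle : ∀ x : V, ∀ f : Fin S.n → ℕ, x = ∑ j, (f j : ℝ) • S.simple j → ⟪α, x⟫ ≤ 0 := by
    intro x f hf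
    rw [hf, inner_sum]
    refine Finset.sum_nonpos fun j _ => ?_
    rw [real_inner_smul_right]
    exact mul_nonpos_of_nonneg_of_nonpos (Nat.cast_nonneg _) (hcs j)
  have h0 := hcon 0
  rw [S.alpha_zero 0 rfl] at h0
  by_cases hp : α ∈ S.Rpos
  · obtain ⟨f, hf⟩ := S.pos_decomp α hp
    have := hle _ f hf
    linarith
  · rcases S.admissible with ⟨-, ha⟩ | ⟨-, ha⟩
    · rw [ha, inner_neg_right] at h0
      -- all short roots are orthogonal to α
      have hA : ∀ γ ∈ S.R0, ⟪γ, γ⟫ = ⟪S.hs, S.hs⟫ → 0 ≤ ⟪α, γ⟫ := by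
        intro γ hγ hγs
        obtain ⟨f, hf⟩ := S.hs_highest γ hγ hγs
        have := hle _ f hf
        rw [inner_sub_right] at this
        linarith
      have hB : ∀ γ ∈ S.R0, ⟪γ, γ⟫ = ⟪S.hs, S.hs⟫ → ⟪α, γ⟫ = 0 := by
        intro γ hγ hγs
        have h1 := hA γ hγ hγs
        have h2 := hA (-γ) (S.neg_mem_R0 hγ) (by rw [inner_neg_neg, hγs])
        rw [inner_neg_right] at h2
        linarith
      apply S.irred
      refine ⟨{β | β ∈ S.R0 ∧ ∃ γ ∈ S.R0, ⟪γ, γ⟫ = ⟪S.hs, S.hs⟫ ∧ ⟪γ, β⟫ ≠ 0},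
        {β | β ∈ S.R0 ∧ ∀ γ ∈ S.R0, ⟪γ, γ⟫ = ⟪S.hs, S.hs⟫ → ⟪γ, β⟫ = 0},
        ⟨S.hs, S.pos_subset S.hs_mem, S.hs, S.pos_subset S.hs_mem, rfl,
          (S.inner_self_pos (S.pos_subset S.hs_mem)).ne'⟩,
        ⟨α, hα, fun γ hγ h => by rw [real_inner_comm]; exact hB γ hγ h⟩, ?_, ?_⟩
      · ext β
        simp only [Set.mem_union, Set.mem_ofPred_eq, SetLike.mem_coe]
        constructor
        · rintro (h | h) <;> exact h.1
        · intro h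
          by_cases h' : ∃ γ ∈ S.R0, ⟪γ, γ⟫ = ⟪S.hs, S.hs⟫ ∧ ⟪γ, β⟫ ≠ 0
          · exact Or.inl ⟨h, h'⟩
          · push Not at h'
            exact Or.inr ⟨h, h'⟩
      · rintro β ⟨hβ, γ, hγ, hγs, hne⟩ δ ⟨hδ, hδ2⟩
        have h1 := hδ2 γ hγ hγs
        have h2 := hδ2 _ (S.refl_mem β hβ γ hγ) ((S.refl_norm hβ γ).trans hγs)
        rw [inner_sub_left, h1, real_inner_smul_left, inner_coroot_eq] at h2
        have h3 := S.inner_self_pos hβ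
        have h4 : 2 / ⟪β, β⟫ * ⟪γ, β⟫ ≠ 0 := mul_ne_zero (by positivity) hne
        have h5 : 2 / ⟪β, β⟫ * ⟪γ, β⟫ * ⟪β, δ⟫ = 0 := by linarith
        exact (mul_eq_zero.1 h5).resolve_left h4
    · rw [ha, inner_neg_right] at h0
      obtain ⟨f, hf⟩ := S.hroot_highest (-α) (S.neg_mem_R0 hα)
      have := hle _ f hf
      rw [inner_sub_right, inner_neg_right] at this
      linarith

/-- the affine reflection attached to an encoded affine root -/
def srefl (p : V × ℤ) : Equiv.Perm V := reflP p.1 (S.m p.1 * (p.2 : ℝ) * (S.c : ℝ))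

/-- encoded simple affine roots -/
def proot (j : Fin (S.n + 1)) : V × ℤ := (S.alpha j, if (j : ℕ) = 0 then 1 else 0)

lemma proot_const (j : Fin (S.n + 1)) :
    S.m (S.proot j).1 * ((S.proot j).2 : ℝ) * (S.c : ℝ) = S.kconst j := by
  refine Fin.cases ?_ (fun i => ?_) j
  · simp [proot, kconst, S.alpha_zero 0 rfl, S.m_a0]
  · simp [proot, kconst]

lemma srefl_proot (j : Fin (S.n + 1)) : S.srefl (S.proot j) = S.sgen j := by
  rw [srefl, sgen, proot_const]; rfl

lemma affval_proot (j : Fin (S.n + 1)) (x : V) : S.affval (S.proot j) x = S.aFun j x := by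
  rw [affval, aFun, proot_const]; rfl

lemma srefl_apply (p : V × ℤ) (x : V) : S.srefl p x = x - S.affval p x • p.1 := rfl

lemma sgen_apply (j : Fin (S.n + 1)) (x : V) : S.sgen j x = x - S.aFun j x • S.alpha j := rfl

lemma sgen_sgen (j : Fin (S.n + 1)) (x : V) : S.sgen j (S.sgen j x) = x :=
  refl_involutive (S.alpha j) (S.kconst j) x

lemma sgen_inv (j : Fin (S.n + 1)) : (S.sgen j)⁻¹ = S.sgen j := by
  rw [inv_eq_iff_mul_eq_one]
  ext x
  exact S.sgen_sgen j x

lemma affval_eq {p : V × ℤ} (hp : p.1 ∈ S.R0) (x : V) :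
    S.affval p x = S.m p.1 * (⟪x, S.hat p.1⟫ + p.2 * S.c) := by
  rw [affval, S.coroot_eq_hat hp]; ring

lemma proot_mem (j : Fin (S.n + 1)) : S.proot j ∈ S.RplusP := by
  refine ⟨S.alpha_mem j, ?_⟩
  refine Fin.cases ?_ (fun i => ?_) j
  · simp [proot]
  · right
    simp only [proot, alpha_succ]
    exact ⟨by simp, S.simple_mem i⟩

lemma affval_pos_of {x0 : V} (h1 : ∀ α ∈ S.Rpos, 0 < ⟪x0, α⟫)
    (h2 : ∀ α ∈ S.R0, |⟪x0, S.hat α⟫| < S.c) {p : V × ℤ} (hp : p ∈ S.RplusP) :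
    0 < S.affval p x0 := by
  obtain ⟨hp0, hp1⟩ := hp
  rw [S.affval_eq hp0]
  refine mul_pos (S.m_pos hp0) ?_
  rcases hp1 with hr | ⟨hr, hpp⟩
  · have h3 := (abs_lt.1 (h2 _ hp0)).1
    have hc : (1 : ℝ) < S.c := by exact_mod_cast S.c_gt
    have hr' : (1 : ℝ) ≤ p.2 := by exact_mod_cast hr
    nlinarith
  · obtain ⟨u, hu, hh⟩ := S.hat_pos hp0
    rw [hr, hh, real_inner_smul_right]
    have := mul_pos hu (h1 _ hpp)
    simpa using this

lemma affval_nonneg_of_alc {x : V} (hx : x ∈ S.Alc) {p : V × ℤ} (hp : p ∈ S.RplusP) :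
    0 ≤ S.affval p x := by
  obtain ⟨hp0, hp1⟩ := hp
  rw [S.affval_eq hp0]
  refine mul_nonneg (S.m_pos hp0).le ?_
  have hc : (1 : ℝ) < S.c := by exact_mod_cast S.c_gt
  rcases hp1 with hr | ⟨hr, hpp⟩
  · have hr' : (1 : ℝ) ≤ p.2 := by exact_mod_cast hr
    have h3 : -(S.c : ℝ) ≤ ⟪x, S.hat p.1⟫ := by
      by_cases hpp : p.1 ∈ S.Rpos
      · have := (hx _ hpp).1; linarith
      · have := (hx _ (S.neg_of_not_pos hp0 hpp)).2
        rw [hat_neg, inner_neg_right] at this; linarith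
    nlinarith
  · rw [hr]
    have := (hx _ hpp).1
    simpa using this

/-- action of simple reflections on positive affine roots -/
lemma exists_act (j : Fin (S.n + 1)) {p : V × ℤ} (hp : p ∈ S.RplusP) (hne : p ≠ S.proot j) :
    ∃ q ∈ S.RplusP, q.1 = p.1 - ⟪p.1, coroot (S.alpha j)⟫ • S.alpha j ∧
      ∀ x, S.affval q x = S.affval p (S.sgen j x) := by
  obtain ⟨hp0, hp1⟩ := hp
  obtain ⟨α, r⟩ := p
  simp only at hp0 hp1
  revert hne
  refine Fin.cases ?_ (fun i => ?_) j
  · intro hne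
    obtain ⟨k, hk⟩ := S.exists_k hp0
    have halpha : S.alpha 0 = S.a0 := S.alpha_zero 0 rfl
    have ha0 := S.a0_mem
    have hmem := S.refl_mem _ ha0 _ hp0
    have hkk : S.m α * k = - ⟪S.a0, coroot α⟫ := by
      rw [S.coroot_eq_hat hp0, ← hk, inner_neg_right, real_inner_comm]; ring
    refine ⟨(α - ⟪α, coroot (S.alpha 0)⟫ • S.alpha 0, r + k), ?_, rfl, ?_⟩
    · refine ⟨by rw [halpha]; exact hmem, ?_⟩
      simp only [halpha]
      -- pairing of the reflected root
      have hk' : ⟪S.hat (α - ⟪α, coroot S.a0⟫ • S.a0), -S.a0⟫ = -k := by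
        have e1 := S.coroot_eq_hat hmem S.a0
        rw [S.coroot_refl ha0 hp0, S.inner_coroot_self ha0, S.m_refl ha0 hp0] at e1
        rw [inner_neg_right, real_inner_comm]
        have hm := S.m_pos hp0
        have : S.m α * ⟪S.a0, S.hat (α - ⟪α, coroot S.a0⟫ • S.a0)⟫ = S.m α * k := by
          rw [← e1, hkk]; ring
        rw [mul_left_cancel₀ hm.ne' this]
      have hposk : k < 0 → α - ⟪α, coroot S.a0⟫ • S.a0 ∈ S.Rpos := by
        intro hk0
        by_contra hc
        have h1 := S.a0_dom (S.neg_of_not_pos hmem hc)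
        rw [hat_neg, inner_neg_left, hk'] at h1
        have : (k : ℝ) < 0 := by exact_mod_cast hk0
        linarith
      rcases hp1 with hr | ⟨hr, hpp⟩
      · by_cases hk2 : k ≤ -2
        · have hα : -α = -S.a0 := by
            apply S.eq_of_two_le (S.neg_mem_R0 hp0)
            rw [hat_neg, inner_neg_left, hk]
            have : (k : ℝ) ≤ -2 := by exact_mod_cast hk2
            linarith
          have hα' : α = S.a0 := neg_injective hα
          have hkeq : k = -2 := by
            have := hkk
            rw [hα', S.m_a0, S.inner_coroot_self ha0] at this
            have : (k : ℝ) = -2 := by linarith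
            exact_mod_cast this
          have hr1 : r ≠ 1 := by
            rintro rfl
            apply hne
            simp [proot, halpha, hα']
          by_cases h3 : 3 ≤ r
          · left; omega
          · right
            exact ⟨by omega, hposk (by omega)⟩
        · by_cases h3 : 1 ≤ r + k
          · exact Or.inl h3
          · right
            exact ⟨by omega, hposk (by omega)⟩
      · have h1 := S.a0_dom hpp
        rw [hk] at h1
        have h1' : 0 ≤ k := by exact_mod_cast h1
        by_cases h3 : 1 ≤ k
        · left; omega
        · right
          have hk0 : k = 0 := by omega
          refine ⟨by omega, ?_⟩
          have : ⟪α, coroot S.a0⟫ = 0 := by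
            rw [hk0] at hkk
            simp only [Int.cast_zero, mul_zero] at hkk
            rw [inner_coroot_eq] at hkk ⊢
            have hpos := S.inner_self_pos hp0
            have : ⟪S.a0, α⟫ = 0 := by
              have h6 : 2 / ⟪α, α⟫ * ⟪S.a0, α⟫ = 0 := by linarith
              exact (mul_eq_zero.1 h6).resolve_left (by positivity)
            rw [real_inner_comm S.a0 α, this, mul_zero]
          rw [this, zero_smul, sub_zero]
          exact hpp
    · intro x
      rw [sgen_apply, aFun]
      simp only [affval, halpha]
      rw [S.coroot_refl ha0 hp0, S.m_refl ha0 hp0, inner_sub_left, real_inner_smul_left]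
      have : S.kconst 0 = S.c := by simp [kconst]
      rw [this]
      push_cast
      linear_combination (S.c : ℝ) * hkk
  · intro hne
    have hj := S.pos_subset (S.simple_mem i)
    refine ⟨(α - ⟪α, coroot (S.simple i)⟫ • S.simple i, r), ⟨S.refl_mem _ hj _ hp0, ?_⟩,
      by rw [alpha_succ], ?_⟩
    · rcases hp1 with hr | ⟨hr, hpp⟩
      · exact Or.inl hr
      · refine Or.inr ⟨hr, S.simple_refl_pos i hpp ?_⟩
        rintro rfl
        apply hne
        simp [proot, alpha_succ, hr]
    · intro x
      rw [sgen_apply, aFun, kconst_succ, alpha_succ]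
      simp only [affval]
      rw [S.coroot_refl hj hp0, S.m_refl hj hp0, inner_sub_left, real_inner_smul_left]
      ring

/-- conjugation of reflections -/
lemma srefl_conj (j : Fin (S.n + 1)) {p q : V × ℤ}
    (h1 : q.1 = p.1 - ⟪p.1, coroot (S.alpha j)⟫ • S.alpha j)
    (h2 : ∀ x, S.affval q x = S.affval p (S.sgen j x)) (x : V) :
    S.srefl q (S.sgen j x) = S.sgen j (S.srefl p x) := by
  rw [srefl_apply, srefl_apply, h2, sgen_sgen, h1, sgen_apply, sgen_apply]
  simp only [aFun, inner_sub_left, real_inner_smul_left]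
  module

lemma srefl_mul (j : Fin (S.n + 1)) {p q : V × ℤ}
    (h1 : q.1 = p.1 - ⟪p.1, coroot (S.alpha j)⟫ • S.alpha j)
    (h2 : ∀ x, S.affval q x = S.affval p (S.sgen j x)) :
    S.srefl q * S.sgen j = S.sgen j * S.srefl p :=
  Equiv.ext fun x => S.srefl_conj j h1 h2 x

/-- The product of the word. -/
def wprod (l : List (Fin (S.n + 1))) : Equiv.Perm V := (l.map S.sgen).prod

lemma wprod_append (l : List (Fin (S.n + 1))) (j : Fin (S.n + 1)) :
    S.wprod (l ++ [j]) = S.wprod l * S.sgen j := by simp [wprod]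

lemma wprod_append_inv (l : List (Fin (S.n + 1))) (j : Fin (S.n + 1)) (y : V) :
    (S.wprod (l ++ [j]))⁻¹ y = S.sgen j ((S.wprod l)⁻¹ y) := by
  rw [wprod_append, mul_inv_rev, sgen_inv]; rfl

lemma srefl_mem_closure {p : V × ℤ} (hp : p ∈ S.RplusP) :
    S.srefl p ∈ Subgroup.closure (Set.range S.sgen) := by
  obtain ⟨x0, hx1, hx2⟩ := S.exists_x0
  have hpos : ∀ p ∈ S.RplusP, 0 < S.affval p x0 := fun p hp => S.affval_pos_of hx1 hx2 hp
  obtain ⟨j0, -, hj0⟩ := Finset.exists_min_image (Finset.univ : Finset (Fin (S.n + 1)))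
    (fun j => S.aFun j x0) ⟨0, by simp⟩
  set ε := S.aFun j0 x0 with hε
  have hεpos : 0 < ε := by
    rw [hε, ← affval_proot]; exact hpos _ (S.proot_mem _)
  have hεle : ∀ j, ε ≤ S.aFun j x0 := fun j => hj0 j (Finset.mem_univ _)
  have main : ∀ N : ℕ, ∀ p ∈ S.RplusP, S.affval p x0 < N * ε →
      S.srefl p ∈ Subgroup.closure (Set.range S.sgen) := by
    intro N
    induction N with
    | zero =>
      intro p hp h
      have := hpos p hp
      simp at h
      linarith
    | succ N ih =>
      intro p hp h
      obtain ⟨j, hj⟩ := S.exists_simple_pos hp.1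
      have hjm : S.sgen j ∈ Subgroup.closure (Set.range S.sgen) :=
        Subgroup.subset_closure ⟨j, rfl⟩
      by_cases hpj : p = S.proot j
      · rw [hpj, srefl_proot]; exact hjm
      · obtain ⟨q, hq, hq1, hq2⟩ := S.exists_act j hp hpj
        have hq3 := ih q hq (by
          rw [hq2, sgen_apply]
          have e : S.affval p (x0 - S.aFun j x0 • S.alpha j) =
              S.affval p x0 - S.aFun j x0 * ⟪S.alpha j, coroot p.1⟫ := by
            simp only [affval, inner_sub_left, real_inner_smul_left]; ring
          rw [e]
          obtain ⟨k, hk⟩ := S.cryst p.1 hp.1 _ (S.alpha_mem j)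
          have hk1 : (1 : ℝ) ≤ ⟪S.alpha j, coroot p.1⟫ := by
            have : 0 < ⟪S.alpha j, coroot p.1⟫ := by
              rw [inner_coroot_eq, real_inner_comm p.1 (S.alpha j)]
              exact mul_pos (div_pos two_pos (S.inner_self_pos hp.1)) hj
            rw [hk] at this ⊢
            have : 0 < k := by exact_mod_cast this
            exact_mod_cast this
          have := hεle j
          push_cast at h
          nlinarith)
        have e := S.srefl_mul j hq1 hq2
        have : S.srefl p = (S.sgen j)⁻¹ * (S.srefl q * S.sgen j) := by
          rw [e]; group
        rw [this]
        exact mul_mem (inv_mem hjm) (mul_mem hq3 hjm)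
  obtain ⟨N, hN⟩ := exists_nat_gt (S.affval p x0 / ε)
  exact main N p hp ((div_lt_iff₀ hεpos).1 hN)

lemma W_eq : S.W = Subgroup.closure (Set.range S.sgen) := by
  apply le_antisymm
  · rw [W, Subgroup.closure_le]
    rintro w ⟨α, hα, r, rfl⟩
    have key : ∀ β ∈ S.R0, ∀ s : ℤ, (β, s) ∈ S.RplusP ∨ (-β, -s) ∈ S.RplusP := by
      intro β hβ s
      by_cases h1 : 1 ≤ s
      · exact Or.inl ⟨hβ, Or.inl h1⟩
      by_cases h2 : s ≤ -1
      · exact Or.inr ⟨S.neg_mem_R0 hβ, Or.inl (by show 1 ≤ -s; omega)⟩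
      have hs0 : s = 0 := by omega
      by_cases h3 : β ∈ S.Rpos
      · exact Or.inl ⟨hβ, Or.inr ⟨hs0, h3⟩⟩
      · exact Or.inr ⟨S.neg_mem_R0 hβ, Or.inr ⟨by show -s = 0; omega, S.neg_of_not_pos hβ h3⟩⟩
    rcases key α hα r with h | h
    · exact S.srefl_mem_closure h
    · have e : reflP α (S.m α * (r : ℝ) * (S.c : ℝ)) = S.srefl (-α, -r) := by
        ext x
        simp only [reflP_apply, srefl, S.m_neg hα, coroot_neg, inner_neg_right]
        push_cast
        module
      show reflP α (S.m α * (r : ℝ) * (S.c : ℝ)) ∈ _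
      rw [e]
      exact S.srefl_mem_closure h
  · rw [Subgroup.closure_le]
    rintro w ⟨j, rfl⟩
    apply Subgroup.subset_closure
    exact ⟨(S.proot j).1, S.alpha_mem j, (S.proot j).2, (S.srefl_proot j).symm⟩

lemma wprod_mem (l : List (Fin (S.n + 1))) : S.wprod l ∈ S.W := by
  rw [W_eq]
  apply Subgroup.list_prod_mem
  intro x hx
  obtain ⟨j, -, rfl⟩ := List.mem_map.1 hx
  exact Subgroup.subset_closure ⟨j, rfl⟩

lemma exists_word {w : Equiv.Perm V} (hw : w ∈ S.W) : ∃ l, S.wprod l = w := by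
  rw [W_eq] at hw
  induction hw using Subgroup.closure_induction with
  | mem x hx => obtain ⟨j, rfl⟩ := hx; exact ⟨[j], by simp [wprod]⟩
  | one => exact ⟨[], rfl⟩
  | mul x y _ _ hx hy =>
    obtain ⟨l, rfl⟩ := hx
    obtain ⟨l', rfl⟩ := hy
    exact ⟨l ++ l', by simp [wprod]⟩
  | inv x _ hx =>
    obtain ⟨l, rfl⟩ := hx
    refine ⟨l.reverse, ?_⟩
    rw [wprod, wprod, List.prod_inv_reverse, List.map_reverse, List.map_map]
    congr 2

lemma exists_reduced {w : Equiv.Perm V} (hw : w ∈ S.W) : ∃ l, S.IsReducedWord l w := by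
  obtain ⟨l, hl⟩ := S.exists_word hw
  have := Nat.sInf_mem (s := {k | ∃ l : List (Fin (S.n + 1)), l.length = k ∧
    (l.map S.sgen).prod = w}) ⟨l.length, l, rfl, hl⟩
  obtain ⟨l', h1, h2⟩ := this
  exact ⟨l', h2, h1⟩

lemma len_le (l : List (Fin (S.n + 1))) : S.len (S.wprod l) ≤ l.length :=
  Nat.sInf_le ⟨l, rfl, rfl⟩

/-- exchange condition -/
lemma exchange {y : V} (hy : y ∈ S.Alc) (l : List (Fin (S.n + 1))) :
    ∀ p ∈ S.RplusP, S.affval p ((S.wprod l)⁻¹ y) < 0 →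
      ∃ l' : List (Fin (S.n + 1)), l'.length + 1 = l.length ∧
        S.wprod l' = S.wprod l * S.srefl p := by
  induction l using List.reverseRecOn with
  | nil =>
    intro p hp h
    have := S.affval_nonneg_of_alc hy hp
    simp [wprod] at h
    linarith
  | append_singleton l i ih =>
    intro p hp h
    rw [wprod_append_inv] at h
    by_cases hpi : p = S.proot i
    · refine ⟨l, by simp, ?_⟩
      rw [hpi, srefl_proot, wprod_append, mul_assoc]
      have : S.sgen i * S.sgen i = 1 := by ext x; exact S.sgen_sgen i x
      rw [this, mul_one]
    · obtain ⟨q, hq, hq1, hq2⟩ := S.exists_act i hp hpi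
      rw [← hq2] at h
      obtain ⟨l', h1, h2⟩ := ih q hq h
      refine ⟨l' ++ [i], by simp [h1], ?_⟩
      rw [wprod_append, wprod_append, h2, mul_assoc, mul_assoc, S.srefl_mul i hq1 hq2]

/-- `l` is a shortest word leading from `y` to its endpoint. -/
def MinWord (y : V) (l : List (Fin (S.n + 1))) : Prop :=
  ∀ l', (S.wprod l')⁻¹ y = (S.wprod l)⁻¹ y → l.length ≤ l'.length

lemma MinWord.of_append {S : Setup V} {y : V} {l : List (Fin (S.n + 1))} {j : Fin (S.n + 1)}
    (h : S.MinWord y (l ++ [j])) : S.MinWord y l := by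
  intro l' hl'
  have := h (l' ++ [j]) (by rw [wprod_append_inv, wprod_append_inv, hl'])
  simpa using this

lemma MinWord.desc {S : Setup V} {y : V} (hy : y ∈ S.Alc) {l : List (Fin (S.n + 1))}
    {j : Fin (S.n + 1)} (h : S.MinWord y (l ++ [j])) : 0 < S.aFun j ((S.wprod l)⁻¹ y) := by
  by_contra! hle
  rcases hle.lt_or_eq with hlt | heq
  · rw [← affval_proot] at hlt
    obtain ⟨l', h1, h2⟩ := S.exchange hy l _ (S.proot_mem j) hlt
    have := h l' (by rw [h2, srefl_proot, wprod_append])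
    simp at this
    omega
  · have := h l (by rw [wprod_append_inv, sgen_apply, heq, zero_smul, sub_zero])
    simp at this

/-- elementary step of the orbit order -/
def ostep (y z : V) : Prop := ∃ p ∈ S.RplusP, 0 < S.affval p y ∧ z = S.srefl p y

/-- the orbit order -/
def ole (y z : V) : Prop := Relation.ReflTransGen S.ostep y z

lemma ostep_dist {x0 : V} (h0 : ∀ p ∈ S.RplusP, 0 < S.affval p x0) {y z : V}
    (h : S.ostep y z) : dist y x0 < dist z x0 := by
  obtain ⟨p, hp, hy, rfl⟩ := h
  rw [dist_eq_norm, dist_eq_norm]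
  apply lt_of_pow_lt_pow_left₀ 2 (norm_nonneg _)
  rw [← real_inner_self_eq_norm_sq, ← real_inner_self_eq_norm_sq]
  have hx := h0 p hp
  have hpp := S.inner_self_pos hp.1
  have e : S.affval p y - S.affval p x0 = 2 / ⟪p.1, p.1⟫ * ⟪y - x0, p.1⟫ := by
    rw [← inner_coroot_eq, inner_sub_left]; simp only [affval]; ring
  have e2 : ⟪y - x0, p.1⟫ = ⟪p.1, p.1⟫ / 2 * (S.affval p y - S.affval p x0) := by
    rw [e]; field_simp
  have e3 : S.srefl p y - x0 = (y - x0) - S.affval p y • p.1 := by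
    rw [srefl_apply]; abel
  rw [e3, real_inner_sub_sub_self (y - x0), real_inner_smul_right, real_inner_smul_right,
    real_inner_smul_left, e2]
  have := mul_pos hpp (mul_pos hy hx)
  nlinarith

lemma ole_dist {x0 : V} (h0 : ∀ p ∈ S.RplusP, 0 < S.affval p x0) {y z : V}
    (h : S.ole y z) : y = z ∨ dist y x0 < dist z x0 := by
  unfold ole at h
  induction h with
  | refl => exact Or.inl rfl
  | tail _ hs ih =>
    right
    have := S.ostep_dist h0 hs
    rcases ih with rfl | ih
    · exact this
    · exact ih.trans this

lemma ole_lift (j : Fin (S.n + 1)) {y z : V} (h : S.ole y z) :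
    S.ole (S.sgen j y) z ∨ S.ole (S.sgen j y) (S.sgen j z) := by
  unfold ole at *
  induction h using Relation.ReflTransGen.head_induction_on with
  | refl => exact Or.inr .refl
  | head hs hle ih =>
    obtain ⟨p, hp, hy, rfl⟩ := hs
    by_cases hpj : p = S.proot j
    · left
      rw [hpj, srefl_proot] at hle
      exact hle
    · obtain ⟨q, hq, hq1, hq2⟩ := S.exists_act j hp hpj
      have hst : S.ostep (S.sgen j _) (S.sgen j (S.srefl p _)) :=
        ⟨q, hq, by rw [hq2, sgen_sgen]; exact hy, (S.srefl_conj j hq1 hq2 _).symm⟩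
      rcases ih with ih | ih
      · exact Or.inl (.head hst ih)
      · exact Or.inr (.head hst ih)

/-- the convex hull of the lower set -/
def Cset (z : V) : Set V := convexHull ℝ {y | S.ole y z}

lemma self_mem_Cset (z : V) : z ∈ S.Cset z := subset_convexHull ℝ _ (Relation.ReflTransGen.refl)

lemma Cset_dist {x0 : V} (h0 : ∀ p ∈ S.RplusP, 0 < S.affval p x0) {μ z : V}
    (h : μ ∈ S.Cset z) (hne : μ ≠ z) : dist μ x0 < dist z x0 := by
  have hconv : Convex ℝ {y : V | y = z ∨ dist y x0 < dist z x0} := by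
    rw [convex_iff_forall_pos]
    intro x hx y hy a b ha hb hab
    have hd : dist (a • x + b • y) x0 ≤ a * dist x x0 + b * dist y x0 := by
      rw [dist_eq_norm, dist_eq_norm, dist_eq_norm]
      have e : a • x + b • y - x0 = a • (x - x0) + b • (y - x0) := by
        have hx0 : x0 = (a + b) • x0 := by rw [hab, one_smul]
        nth_rewrite 1 [hx0]
        module
      rw [e]
      refine (norm_add_le _ _).trans ?_
      rw [norm_smul, norm_smul, Real.norm_of_nonneg ha.le, Real.norm_of_nonneg hb.le]
    have hz : a * dist z x0 + b * dist z x0 = dist z x0 := by rw [← add_mul, hab, one_mul]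
    rcases hx with rfl | hx <;> rcases hy with rfl | hy
    · left; rw [← add_smul, hab, one_smul]
    · right; have := mul_lt_mul_of_pos_left hy hb; show dist _ _ < _; linarith
    · right; have := mul_lt_mul_of_pos_left hx ha; show dist _ _ < _; linarith
    · right
      have h1 := mul_lt_mul_of_pos_left hx ha
      have h2 := mul_lt_mul_of_pos_left hy hb
      show dist _ _ < _
      linarith
  have hsub := convexHull_min (s := {y | S.ole y z}) (fun y hy => S.ole_dist h0 hy) hconv
  exact (hsub h).resolve_left hne

lemma sgen_ole {j : Fin (S.n + 1)} {z : V} (hz : 0 < S.aFun j z) : S.ole z (S.sgen j z) :=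
  .single ⟨S.proot j, S.proot_mem j, by rwa [affval_proot], by rw [srefl_proot]⟩

lemma Cset_mono {j : Fin (S.n + 1)} {z μ : V} (hz : 0 < S.aFun j z) (h : μ ∈ S.Cset z) :
    μ ∈ S.Cset (S.sgen j z) :=
  convexHull_mono (fun _ hy => Relation.ReflTransGen.trans hy (S.sgen_ole hz)) h

lemma Cset_sgen {j : Fin (S.n + 1)} {z μ : V} (hz : 0 < S.aFun j z) (h : μ ∈ S.Cset z) :
    S.sgen j μ ∈ S.Cset (S.sgen j z) := by
  have hconv : Convex ℝ {y : V | S.sgen j y ∈ S.Cset (S.sgen j z)} := by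
    intro x hx y hy a b ha hb hab
    have e : S.sgen j (a • x + b • y) = a • S.sgen j x + b • S.sgen j y := by
      simp only [sgen_apply, aFun, inner_add_left, real_inner_smul_left]
      have : S.kconst j = (a + b) * S.kconst j := by rw [hab, one_mul]
      nth_rewrite 1 [this]
      module
    show S.sgen j (a • x + b • y) ∈ S.Cset (S.sgen j z)
    rw [e]
    exact convex_convexHull ℝ _ hx hy ha hb hab
  refine convexHull_min (s := {y | S.ole y z}) (fun y hy => ?_) hconv h
  apply subset_convexHull
  rcases S.ole_lift j hy with h | h
  · exact Relation.ReflTransGen.trans h (S.sgen_ole hz)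
  · exact h

/-- evaluation functional -/
def evf (x : ↥S.Plat) : (↥S.Plat → ℂ) → ℂ := fun f => f x

lemma Plat_sub {x : V} (hx : x ∈ S.Plat) {α : V} (hα : α ∈ S.R0) (k : ℤ) :
    x - (k : ℝ) • α ∈ S.Plat := by
  intro β hβ
  obtain ⟨a, ha⟩ := hx β hβ
  obtain ⟨b, hb⟩ := S.cryst β hβ α hα
  refine ⟨a - k * b, ?_⟩
  rw [inner_sub_left, real_inner_smul_left, ha, hb]; push_cast; ring

lemma aFun_int {x : V} (hx : x ∈ S.Plat) (j : Fin (S.n + 1)) : ∃ k : ℤ, S.aFun j x = k := by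
  obtain ⟨a, ha⟩ := hx _ (S.alpha_mem j)
  refine ⟨a + if (j : ℕ) = 0 then S.c else 0, ?_⟩
  rw [aFun, ha, kconst]
  split_ifs <;> simp

lemma sgen_Plat {x : V} (hx : x ∈ S.Plat) (j : Fin (S.n + 1)) : S.sgen j x ∈ S.Plat := by
  obtain ⟨k, hk⟩ := S.aFun_int hx j
  rw [sgen_apply, hk]
  exact S.Plat_sub hx (S.alpha_mem j) k

lemma ev_of_mem (f : ↥S.Plat → ℂ) {x : V} (hx : x ∈ S.Plat) : S.ev f x = f ⟨x, hx⟩ := by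
  simp [ev, hx]

/-- the segment functionals -/
lemma string_mem {x : V} {k a : ℤ} (j : Fin (S.n + 1)) (ha : S.aFun j x = a)
    (h : (0 ≤ k ∧ k ≤ a) ∨ (a ≤ k ∧ k ≤ 0)) :
    x - (k : ℝ) • S.alpha j ∈ segment ℝ x (S.sgen j x) := by
  rw [segment_eq_image']
  by_cases ha0 : a = 0
  · have : k = 0 := by omega
    subst this
    exact ⟨0, by simp, by simp⟩
  refine ⟨(k : ℝ) / a, ?_, ?_⟩
  · rcases h with ⟨h1, h2⟩ | ⟨h1, h2⟩
    · have : (0 : ℝ) < a := by exact_mod_cast (by omega : 0 < a)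
      have h1' : (0 : ℝ) ≤ k := by exact_mod_cast h1
      exact ⟨by positivity, by rw [div_le_one this]; exact_mod_cast h2⟩
    · have : (a : ℝ) < 0 := by exact_mod_cast (by omega : a < 0)
      have h1' : (k : ℝ) ≤ 0 := by exact_mod_cast h2
      exact ⟨div_nonneg_of_nonpos h1' this.le,
        by rw [div_le_one_of_neg this]; exact_mod_cast h1⟩
  · have : (a : ℝ) ≠ 0 := by exact_mod_cast ha0
    simp only [sgen_apply, ha]
    rw [sub_sub_cancel_left, smul_neg, smul_smul, div_mul_cancel₀ _ this]
    abel

/-- `T_j` at `x` involves only the values on the segment from `x` to `s_j x`. -/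
lemma Top_mem_span (j : Fin (S.n + 1)) (x : ↥S.Plat) :
    (fun f => S.Top j f x) ∈ Submodule.span ℂ
      (S.evf '' {μ | (μ : V) ∈ segment ℝ (x : V) (S.sgen j x)}) := by
  set M := Submodule.span ℂ (S.evf '' {μ | (μ : V) ∈ segment ℝ (x : V) (S.sgen j x)}) with hM
  have hev : ∀ y : V, y ∈ S.Plat → y ∈ segment ℝ (x : V) (S.sgen j x) →
      (fun f => S.ev f y) ∈ M := by
    intro y hy hy2
    have : (fun f => S.ev f y) = S.evf ⟨y, hy⟩ := by
      funext f; exact S.ev_of_mem f hy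
    rw [this]
    exact Submodule.subset_span ⟨⟨y, hy⟩, hy2, rfl⟩
  obtain ⟨a, ha⟩ := S.aFun_int x.2 j
  have hfl : ⌊S.aFun j x⌋ = a := by rw [ha, Int.floor_intCast]
  have hJ : (fun f => S.Jop j f x) ∈ M := by
    simp only [Jop, hfl]
    split_ifs with h1 h2
    · have : (fun f => -∑ k ∈ Finset.Icc (1 : ℤ) a, S.ev f (x.1 - (k : ℝ) • S.alpha j)) =
          -∑ k ∈ Finset.Icc (1 : ℤ) a, (fun f => S.ev f (x.1 - (k : ℝ) • S.alpha j)) := by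
        funext f; simp
      rw [this]
      refine Submodule.neg_mem _ (Submodule.sum_mem _ fun k hk => ?_)
      rw [Finset.mem_Icc] at hk
      exact hev _ (S.Plat_sub x.2 (S.alpha_mem j) k) (S.string_mem j ha (by omega))
    · have : (fun f => ∑ k ∈ Finset.Icc (0 : ℤ) (-a - 1), S.ev f (x.1 + (k : ℝ) • S.alpha j)) =
          ∑ k ∈ Finset.Icc (0 : ℤ) (-a - 1),
            (fun f => S.ev f (x.1 - ((-k : ℤ) : ℝ) • S.alpha j)) := by
        funext f; simp
      rw [this]
      refine Submodule.sum_mem _ fun k hk => ?_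
      rw [Finset.mem_Icc] at hk
      exact hev _ (S.Plat_sub x.2 (S.alpha_mem j) (-k)) (S.string_mem j ha (by omega))
    · exact Submodule.zero_mem _
  have : (fun f => S.Top j f x) = (S.t (S.alpha j) : ℂ) • (fun f => S.ev f (S.sgen j x.1)) +
      ((S.t (S.alpha j) : ℂ) - 1) • (fun f => S.Jop j f x) := by
    funext f
    simp [Top, sgen_inv]
  rw [this]
  exact Submodule.add_mem _
    (Submodule.smul_mem _ _ (hev _ (S.sgen_Plat x.2 j) (right_mem_segment ℝ _ _)))
    (Submodule.smul_mem _ _ hJ)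

/-- leading term of `T_j` at a point on the positive side -/
lemma Top_lead (j : Fin (S.n + 1)) (x : ↥S.Plat) (hx : 0 < S.aFun j x) :
    (fun f => S.Top j f x) - S.evf ⟨S.sgen j x, S.sgen_Plat x.2 j⟩ ∈ Submodule.span ℂ
      (S.evf '' {μ | (μ : V) ∈ segment ℝ (x : V) (S.sgen j x) ∧ (μ : V) ≠ S.sgen j x}) := by
  set M := Submodule.span ℂ
    (S.evf '' {μ | (μ : V) ∈ segment ℝ (x : V) (S.sgen j x) ∧ (μ : V) ≠ S.sgen j x}) with hM
  obtain ⟨a, ha⟩ := S.aFun_int x.2 j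
  have hfl : ⌊S.aFun j x⌋ = a := by rw [ha, Int.floor_intCast]
  have ha0 : 0 < a := by rw [ha] at hx; exact_mod_cast hx
  have hα : S.alpha j ≠ 0 := fun h => S.zero_not_mem (h ▸ S.alpha_mem j)
  have hIcc : Finset.Icc (1 : ℤ) a = insert a (Finset.Icc (1 : ℤ) (a - 1)) := by
    ext k; simp only [Finset.mem_insert, Finset.mem_Icc]; omega
  have hs : x.1 - (a : ℝ) • S.alpha j = S.sgen j x := by rw [sgen_apply, ha]
  have : (fun f => S.Top j f x) - S.evf ⟨S.sgen j x, S.sgen_Plat x.2 j⟩ =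
      (-((S.t (S.alpha j) : ℂ) - 1)) • ∑ k ∈ Finset.Icc (1 : ℤ) (a - 1),
        (fun f => S.ev f (x.1 - (k : ℝ) • S.alpha j)) := by
    funext f
    simp only [Top, Jop, hfl, sgen_inv, if_pos ha0, hIcc, Pi.sub_apply, Pi.smul_apply,
      Finset.sum_apply, smul_eq_mul]
    rw [Finset.sum_insert (by simp), hs, S.ev_of_mem f (S.sgen_Plat x.2 j), evf]
    ring
  rw [this]
  refine Submodule.smul_mem _ _ (Submodule.sum_mem _ fun k hk => ?_)
  rw [Finset.mem_Icc] at hk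
  have hy := S.Plat_sub x.2 (S.alpha_mem j) k
  have : (fun f => S.ev f (x.1 - (k : ℝ) • S.alpha j)) = S.evf ⟨_, hy⟩ := by
    funext f; exact S.ev_of_mem f hy
  rw [this]
  refine Submodule.subset_span ⟨_, ⟨S.string_mem j ha (by omega), ?_⟩, rfl⟩
  show x.1 - (k : ℝ) • S.alpha j ≠ S.sgen j x
  rw [← hs]
  intro h
  have h2 := smul_left_injective ℝ hα (sub_right_injective h)
  have : k = a := by exact_mod_cast h2
  omega

lemma wordOp_append (l : List (Fin (S.n + 1))) (j : Fin (S.n + 1)) (f : ↥S.Plat → ℂ) :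
    S.wordOp (l ++ [j]) f = S.wordOp l (S.Top j f) := by
  unfold wordOp
  induction l with
  | nil => rfl
  | cons i l ih =>
    simp only [List.cons_append, List.foldr_cons, Function.comp]
    rw [ih]

lemma wprod_inv_Plat {y : V} (hy : y ∈ S.Plat) (l : List (Fin (S.n + 1))) :
    (S.wprod l)⁻¹ y ∈ S.Plat := by
  induction l using List.reverseRecOn with
  | nil => simpa [wprod] using hy
  | append_singleton l j ih => rw [wprod_append_inv]; exact S.sgen_Plat ih j

/-- triangularity -/
lemma triangular {x0 : V} (h0 : ∀ p ∈ S.RplusP, 0 < S.affval p x0)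
    (y : ↥S.Plat) (hy : (y : V) ∈ S.Alc) (l : List (Fin (S.n + 1))) (hl : S.MinWord y l) :
    (fun f => S.wordOp l f y) - S.evf ⟨(S.wprod l)⁻¹ y, S.wprod_inv_Plat y.2 l⟩ ∈
      Submodule.span ℂ (S.evf '' {μ | (μ : V) ∈ S.Cset ((S.wprod l)⁻¹ y) ∧
        (μ : V) ≠ (S.wprod l)⁻¹ y}) := by
  induction l using List.reverseRecOn with
  | nil =>
    have : (fun f => S.wordOp [] f y) - S.evf ⟨(S.wprod [])⁻¹ y, S.wprod_inv_Plat y.2 []⟩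
        = 0 := by
      funext f
      simp [wordOp, evf, wprod]
    rw [this]
    exact Submodule.zero_mem _
  | append_singleton l j ih =>
    have ih := ih hl.of_append
    have hdesc := hl.desc hy
    set z : ↥S.Plat := ⟨(S.wprod l)⁻¹ y, S.wprod_inv_Plat y.2 l⟩ with hz
    have hzend : (⟨(S.wprod (l ++ [j]))⁻¹ y, S.wprod_inv_Plat y.2 (l ++ [j])⟩ : ↥S.Plat) =
        ⟨S.sgen j z, S.sgen_Plat z.2 j⟩ := Subtype.ext (S.wprod_append_inv l j y)
    rw [hzend, S.wprod_append_inv l j y]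
    change 0 < S.aFun j z at hdesc
    change (fun f => S.wordOp l f y) - S.evf z ∈ Submodule.span ℂ
      (S.evf '' {μ | (μ : V) ∈ S.Cset z ∧ (μ : V) ≠ z}) at ih
    change _ ∈ Submodule.span ℂ
      (S.evf '' {μ | (μ : V) ∈ S.Cset (S.sgen j z) ∧ (μ : V) ≠ S.sgen j z})
    set M := Submodule.span ℂ
      (S.evf '' {μ | (μ : V) ∈ S.Cset (S.sgen j z) ∧ (μ : V) ≠ S.sgen j z}) with hM
    have hcv : Convex ℝ (S.Cset (S.sgen j z)) := convex_convexHull ℝ _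
    -- composition with `T_j`
    have hcomp : ∀ K ∈ Submodule.span ℂ (S.evf '' {μ | (μ : V) ∈ S.Cset z ∧ (μ : V) ≠ z}),
        (fun f => K (S.Top j f)) ∈ M := by
      intro K hK
      induction hK using Submodule.span_induction with
      | mem K hK =>
        obtain ⟨μ, ⟨hμ1, hμ2⟩, rfl⟩ := hK
        refine Submodule.span_mono (Set.image_mono ?_) (S.Top_mem_span j μ)
        intro ν hν
        have hA : (μ : V) ∈ S.Cset (S.sgen j z) := S.Cset_mono hdesc hμ1
        have hB : S.sgen j μ ∈ S.Cset (S.sgen j z) := S.Cset_sgen hdesc hμ1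
        refine ⟨hcv.segment_subset hA hB hν, ?_⟩
        have hstep : dist (z : V) x0 < dist (S.sgen j z) x0 :=
          S.ostep_dist h0 ⟨S.proot j, S.proot_mem j, by rwa [affval_proot], by rw [srefl_proot]⟩
        have hA' : dist (μ : V) x0 < dist (S.sgen j z) x0 :=
          (S.Cset_dist h0 hμ1 hμ2).trans hstep
        have hB' : dist (S.sgen j μ) x0 < dist (S.sgen j z) x0 :=
          S.Cset_dist h0 hB fun h => hμ2 ((S.sgen j).injective h)
        have hball := (convex_ball x0 (dist (S.sgen j z) x0)).segment_subset
          (Metric.mem_ball.2 hA') (Metric.mem_ball.2 hB') hν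
        intro h
        rw [h] at hball
        exact lt_irrefl _ (Metric.mem_ball.1 hball)
      | zero => exact Submodule.zero_mem _
      | add K K' _ _ h1 h2 => exact Submodule.add_mem _ h1 h2
      | smul c K _ h1 => exact Submodule.smul_mem _ c h1
    have h1 := hcomp _ ih
    have h2 : (fun f => S.Top j f z) - S.evf ⟨S.sgen j z, S.sgen_Plat z.2 j⟩ ∈ M := by
      refine Submodule.span_mono (Set.image_mono ?_) (S.Top_lead j z hdesc)
      rintro ν ⟨hν, hν2⟩
      exact ⟨hcv.segment_subset (S.Cset_mono hdesc (S.self_mem_Cset _)) (S.self_mem_Cset _) hν,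
        hν2⟩
    have e : (fun f => S.wordOp (l ++ [j]) f y) - S.evf ⟨S.sgen j z, S.sgen_Plat z.2 j⟩ =
        (fun f => ((fun f => S.wordOp l f y) - S.evf z) (S.Top j f)) +
        ((fun f => S.Top j f z) - S.evf ⟨S.sgen j z, S.sgen_Plat z.2 j⟩) := by
      funext f
      simp [wordOp_append, evf]
    rw [e]
    exact Submodule.add_mem _ h1 h2

lemma finite_ball (x0 : V) (r : ℝ) : {μ : ↥S.Plat | dist (μ : V) x0 < r}.Finite := by
  have hintg : ∀ μ : ↥S.Plat, ∃ g : Fin S.n → ℤ, ∀ j, ⟪(μ : V), coroot (S.simple j)⟫ = g j := by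
    intro μ
    choose g hg using fun j => μ.2 _ (S.pos_subset (S.simple_mem j))
    exact ⟨g, hg⟩
  choose G hG using hintg
  have hinj : Function.Injective G := by
    intro μ ν h
    apply Subtype.ext
    rw [← sub_eq_zero]
    have hz : ∀ j, ⟪(μ : V) - ν, S.simple j⟫ = 0 := by
      intro j
      have h1 : ⟪(μ : V) - ν, coroot (S.simple j)⟫ = 0 := by
        rw [inner_sub_left, hG, hG, h, sub_self]
      rw [inner_coroot_eq] at h1
      have := S.inner_self_pos (S.pos_subset (S.simple_mem j))
      exact (mul_eq_zero.1 h1).resolve_left (by positivity)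
    have hsp : ∀ v ∈ Submodule.span ℝ (Set.range S.simple), ⟪(μ : V) - ν, v⟫ = 0 := by
      intro v hv
      induction hv using Submodule.span_induction with
      | mem x hx => obtain ⟨j, rfl⟩ := hx; exact hz j
      | zero => simp
      | add x y _ _ h1 h2 => rw [inner_add_right, h1, h2, add_zero]
      | smul a x _ h1 => rw [real_inner_smul_right, h1, mul_zero]
    have := hsp ((μ : V) - ν) (by rw [S.simple_span]; trivial)
    exact inner_self_eq_zero.1 this
  apply Set.Finite.of_finite_image _ hinj.injOn
  let B : Fin S.n → ℤ := fun j => ⌈(r + ‖x0‖) * ‖coroot (S.simple j)‖⌉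
  apply (Set.finite_Icc (-B) B).subset
  rintro _ ⟨μ, hμ, rfl⟩
  have key : ∀ j, |(G μ j : ℝ)| ≤ B j := by
    intro j
    rw [← hG]
    refine (abs_real_inner_le_norm _ _).trans (le_trans ?_ (Int.le_ceil _))
    refine mul_le_mul_of_nonneg_right ?_ (norm_nonneg _)
    have h1 : dist (μ : V) x0 < r := hμ
    rw [dist_eq_norm] at h1
    have h2 : ‖(μ : V)‖ ≤ ‖(μ : V) - x0‖ + ‖x0‖ := by
      simpa using norm_add_le ((μ : V) - x0) x0
    linarith
  refine ⟨fun j => ?_, fun j => ?_⟩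
  · have := (abs_le.1 (key j)).1
    show -(B j) ≤ _
    exact_mod_cast this
  · exact_mod_cast (abs_le.1 (key j)).2

end Setup

/-- abstract inversion of triangular systems -/
lemma tri_inv {X : Type*} (N : X → ℕ) (u : X → ℂ) (hu : ∀ x, u x ≠ 0)
    (L : X → (X → ℂ) → ℂ)
    (hL : ∀ x, L x - (fun f => f x) ∈ Submodule.span ℂ
      ((fun (y : X) (f : X → ℂ) => f y) '' {y | N y < N x})) :
    ∃ E : (X → ℂ) ≃ₗ[ℂ] (X → ℂ), ∀ f x, E f x = u x * L x f := by
  set K : X → (X → ℂ) → ℂ := fun x => L x - (fun f => f x) with hK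
  have hLK : ∀ x f, L x f = f x + K x f := by intro x f; simp [hK]
  have hlin : ∀ x, IsLinearMap ℂ (K x) := by
    intro x
    have h := hL x
    change K x ∈ _ at h
    generalize K x = k0 at h ⊢
    induction h using Submodule.span_induction with
    | mem k hk =>
      obtain ⟨y, -, rfl⟩ := hk
      exact ⟨fun _ _ => rfl, fun _ _ => rfl⟩
    | zero => exact ⟨by simp, by simp⟩
    | add k k' _ _ h1 h2 =>
      refine ⟨fun f g => ?_, fun c f => ?_⟩
      · simp only [Pi.add_apply, h1.map_add, h2.map_add]; ring
      · simp only [Pi.add_apply, h1.map_smul, h2.map_smul, smul_add]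
    | smul c k _ h1 =>
      refine ⟨fun f g => ?_, fun d f => ?_⟩
      · simp only [Pi.smul_apply, h1.map_add, smul_add]
      · simp only [Pi.smul_apply, h1.map_smul, smul_comm c d]
  have hloc : ∀ x f g, (∀ y, N y < N x → f y = g y) → K x f = K x g := by
    intro x f g hfg
    have h := hL x
    change K x ∈ _ at h
    generalize K x = k0 at h ⊢
    induction h using Submodule.span_induction with
    | mem k hk =>
      obtain ⟨y, hy, rfl⟩ := hk
      exact hfg y hy
    | zero => rfl
    | add k k' _ _ h1 h2 => simp only [Pi.add_apply, h1, h2]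
    | smul c k _ h1 => simp only [Pi.smul_apply, h1]
  let T : (X → ℂ) →ₗ[ℂ] (X → ℂ) :=
    { toFun := fun f x => u x * L x f
      map_add' := by
        intro f g; funext x
        simp only [hLK, (hlin x).map_add, Pi.add_apply]; ring
      map_smul' := by
        intro c f; funext x
        simp only [hLK, (hlin x).map_smul, Pi.smul_apply, smul_eq_mul, RingHom.id_apply]; ring }
  have hT : ∀ f x, T f x = u x * L x f := fun _ _ => rfl
  have hinj : Function.Injective T := by
    rw [← LinearMap.ker_eq_bot, LinearMap.ker_eq_bot']
    intro f hf
    have : ∀ n : ℕ, ∀ x, N x = n → f x = 0 := by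
      intro n
      induction n using Nat.strong_induction_on with
      | _ n ih =>
        intro x hx
        have h1 : T f x = 0 := by rw [hf]; rfl
        rw [hT] at h1
        have h2 := (mul_eq_zero.1 h1).resolve_left (hu x)
        rw [hLK, hloc x f 0 (fun y hy => ih (N y) (hx ▸ hy) y rfl), (hlin x).map_zero,
          add_zero] at h2
        exact h2
    funext x
    exact this _ x rfl
  have hsurj : Function.Surjective T := by
    intro g
    have wf : WellFounded (fun x y : X => N x < N y) := InvImage.wf N Nat.lt_wfRel.wf
    let F : ∀ x, (∀ y, N y < N x → ℂ) → ℂ := fun x rec =>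
      (u x)⁻¹ * g x - K x (fun y => if h : N y < N x then rec y h else 0)
    refine ⟨wf.fix F, ?_⟩
    funext x
    rw [hT, hLK]
    have e : wf.fix F x = (u x)⁻¹ * g x - K x (wf.fix F) := by
      rw [wf.fix_eq]
      show (u x)⁻¹ * g x - K x _ = _
      congr 1
      apply hloc
      intro y hy
      simp only [dif_pos hy]
    rw [e, sub_add_cancel, mul_inv_cancel_left₀ (hu x)]
  exact ⟨LinearEquiv.ofBijective T ⟨hinj, hsurj⟩, fun f x => rfl⟩

/-- the affine intertwining operator `𝒥` is an invertible linear operator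
(a linear automorphism of `𝒞(P)`). -/
theorem statement4 (S : Setup V) (htne : ∀ α ∈ S.R0, S.t α ≠ 0)
    (wmin : V → Equiv.Perm V) (hwmin : S.IsShortest wmin)
    (TW : Equiv.Perm V → (↥S.Plat → ℂ) → (↥S.Plat → ℂ)) (hTW : S.IsTW TW) :
    ∃ E : (↥S.Plat → ℂ) ≃ₗ[ℂ] (↥S.Plat → ℂ), ∀ f, E f = S.JJ wmin TW f := by
  obtain ⟨x0, hx1, hx2⟩ := S.exists_x0
  have h0 : ∀ p ∈ S.RplusP, 0 < S.affval p x0 := fun p hp => S.affval_pos_of hx1 hx2 hp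
  have ht : ∀ x : ↥S.Plat, (S.tBr x.1)⁻¹ ≠ 0 := by
    intro x
    apply inv_ne_zero
    unfold Setup.tBr
    refine finprod_mem_induction (fun z : ℂ => z ≠ 0) one_ne_zero (fun _ _ => mul_ne_zero) ?_
    intro p hp
    have := htne p.1 hp.1.1
    exact_mod_cast this
  have hN : ∀ x y : ↥S.Plat, dist (y : V) x0 < dist (x : V) x0 →
      Set.ncard {μ : ↥S.Plat | dist (μ : V) x0 < dist (y : V) x0} <
        Set.ncard {μ : ↥S.Plat | dist (μ : V) x0 < dist (x : V) x0} := by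
    intro x y hxy
    refine Set.ncard_lt_ncard ?_ (S.finite_ball x0 _)
    refine ⟨fun μ hμ => lt_trans hμ hxy, fun hsub => ?_⟩
    exact lt_irrefl (dist (y : V) x0) (hsub (show y ∈ {μ : ↥S.Plat | dist (μ : V) x0 < dist (x : V) x0} from hxy))
  obtain ⟨E, hE⟩ := tri_inv
    (fun x : ↥S.Plat => Set.ncard {μ : ↥S.Plat | dist (μ : V) x0 < dist (x : V) x0})
    (fun x => (S.tBr x.1)⁻¹) ht
    (fun x f => S.ev (TW (wmin x.1) f) (wmin x.1 x.1)) (by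
      intro x
      obtain ⟨hW, hA, hmin⟩ := hwmin x.1
      obtain ⟨l, hl⟩ := S.exists_reduced hW
      have hlw : S.wprod l = wmin x.1 := hl.1
      have hTl := hTW _ _ hl
      have hwx : (S.wprod l)⁻¹ (wmin x.1 x.1) = x.1 := by
        rw [hlw]; exact (wmin x.1).symm_apply_apply x.1
      have hyP : wmin x.1 x.1 ∈ S.Plat := by
        rw [← hlw]
        clear hwx hTl hlw hl
        induction l with
        | nil => simpa [Setup.wprod] using x.2
        | cons j l ih =>
          have : S.wprod (j :: l) = S.sgen j * S.wprod l := by simp [Setup.wprod]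
          rw [this]
          exact S.sgen_Plat ih j
      have hMin : S.MinWord (wmin x.1 x.1) l := by
        intro l' hl'
        rw [hwx] at hl'
        have h1 : S.wprod l' x.1 = wmin x.1 x.1 := by
          exact ((S.wprod l').symm_apply_eq.1 hl').symm
        have h2 := (hmin _ (S.wprod_mem l') (by rw [h1]; exact hA)).1
        rw [hl.2]
        exact h2.trans (S.len_le l')
      have key := S.triangular h0 ⟨_, hyP⟩ hA l hMin
      have e2 : (fun f => S.ev (TW (wmin x.1) f) (wmin x.1 x.1)) =
          fun f => S.wordOp l f ⟨_, hyP⟩ := by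
        funext f
        rw [S.ev_of_mem _ hyP, hTl]
      simp only [hwx] at key
      rw [e2]
      refine Submodule.span_mono (Set.image_mono ?_) key
      rintro μ ⟨hμ1, hμ2⟩
      exact hN x μ (S.Cset_dist h0 hμ1 hμ2))
  exact ⟨E, fun f => funext fun x => hE f x⟩

end AffinePieri
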